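/- arXiv:2305.06010 — 2 statements merged into one kernel-verified Lean document; each statement's English description precedes it below -/
import Mathlib

section
/- Infinite-horizon performance-loss bound for the one-step receding-horizon policy: let (A_t)_{t∈ℕ} ⊂ ℝ^{n×n}, (B_t)_{t∈ℕ} ⊂ ℝ^{n×m}, symmetric positive definite (Q_t)_{t∈ℕ} ⊂ ℝ^{n×n} and symmetric positive definite (R_t)_{t∈ℕ} ⊂ ℝ^{m×m} be given, and suppose the contraction inequality δ(𝓡_t(Y), 𝓡_t(Z)) ≤ δ(Y,Z) holds for all t ∈ ℕ and all symmetric positive definite Y, Z. Let (P_t)_{t∈ℕ} be symmetric positive definite matrices with P_t = 𝓡_t(P_{t+1}) for all t, and let (X̂_{t+1})_{t∈ℕ} be symmetric positive definite matrices such that, for all t ≥ 1: 𝓡_t(X̂_{t+1}) ⪯ X̂_t, P_t ⪯ X̂_t, and δ(X̂_t, P_t) ≤ η, for some η > 0. Let K_t := (R_t + B_tᵀ X̂_{t+1} B_t)⁻¹ B_tᵀ X̂_{t+1} A_t, and from initial state x_0 = ξ ∈ ℝⁿ let x_{t+1} = A_t x_t + B_t u_t with u_t = −K_t x_t. Suppose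 ω̄, ω̲, λ̲, λ̄ > 0 are constants with, for all t ∈ ℕ: ‖𝓡_t(X̂_{t+1})‖₂ ≤ ω̄, λ_min(𝓡_t(X̂_{t+1})) ≥ ω̲, λ_min(Q_t + K_tᵀ R_t K_t) ≥ λ̲, λ̲ ≤ ω̄, and ‖P_t‖₂ ≤ λ̄. Then the series Σ_{t=0}^∞ (x_tᵀ Q_t x_t + u_tᵀ R_t u_t) converges and Σ_{t=0}^∞ (x_tᵀ Q_t x_t + u_tᵀ R_t u_t) − ξᵀ P_0 ξ ≤ (λ̄/λ̲) · (ω̄/ω̲) · ω̄ · (exp(η) − 1) · |ξ|². -/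
open Matrix

/-- The spectral (operator) norm of a real square matrix, induced by the Euclidean norm. -/
noncomputable def specNorm {n : ℕ} (M : Matrix (Fin n) (Fin n) ℝ) : ℝ :=
  ‖Matrix.toEuclideanCLM (𝕜 := ℝ) M‖

/-- The smallest eigenvalue of a (symmetric) real square matrix. -/
noncomputable def lamMin {n : ℕ} (M : Matrix (Fin n) (Fin n) ℝ) : ℝ :=
  sInf (spectrum ℝ M)

/-- The Riemannian distance `δ(Y,Z) = sqrt (Σᵢ (log λᵢ)²)` where `λ₁, …, λₙ` are the
eigenvalues, with multiplicity, of `Y Z⁻¹` (equivalently, of `Z^{-1/2} Y Z^{-1/2}`),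
realized as the roots of its characteristic polynomial. -/
noncomputable def riemDelta {n : ℕ} (Y Z : Matrix (Fin n) (Fin n) ℝ) : ℝ :=
  Real.sqrt ((((Y * Z⁻¹).charpoly.roots).map (fun r => Real.log r ^ 2)).sum)

/-- The time-`t` Riccati operator
`𝓡_t(P) = Q_t + A_tᵀ (P − P B_t (R_t + B_tᵀ P B_t)⁻¹ B_tᵀ P) A_t`. -/
noncomputable def ricc {n m : ℕ} (A : Matrix (Fin n) (Fin n) ℝ) (B : Matrix (Fin n) (Fin m) ℝ)
    (Q : Matrix (Fin n) (Fin n) ℝ) (R : Matrix (Fin m) (Fin m) ℝ)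
    (P : Matrix (Fin n) (Fin n) ℝ) : Matrix (Fin n) (Fin n) ℝ :=
  Q + Aᵀ * (P - P * B * (R + Bᵀ * P * B)⁻¹ * (Bᵀ * P)) * A

/-- Completing the square in the Riccati operator. -/
lemma ricc_closed_loop {n m : ℕ} (A : Matrix (Fin n) (Fin n) ℝ) (B : Matrix (Fin n) (Fin m) ℝ)
    (Q : Matrix (Fin n) (Fin n) ℝ) (R : Matrix (Fin m) (Fin m) ℝ)
    (X : Matrix (Fin n) (Fin n) ℝ) (K : Matrix (Fin m) (Fin n) ℝ)
    (hR : R.PosDef) (hX : X.PosDef)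
    (hK : K = (R + Bᵀ * X * B)⁻¹ * (Bᵀ * X * A)) :
    ricc A B Q R X = Q + Kᵀ * R * K + (A - B * K)ᵀ * X * (A - B * K) := by
  have hG : (R + Bᵀ * X * B).PosDef := by
    have := hX.posSemidef.conjTranspose_mul_mul_same B
    rw [conjTranspose_eq_transpose_of_trivial] at this
    exact hR.add_posSemidef this
  have hdet : IsUnit (R + Bᵀ * X * B).det := (Matrix.isUnit_iff_isUnit_det _).1 hG.isUnit
  have hGK : (R + Bᵀ * X * B) * K = Bᵀ * X * A := by
    rw [hK, Matrix.mul_nonsing_inv_cancel_left _ _ hdet]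
  have h1 : Kᵀ * R * K = Kᵀ * (Bᵀ * X * A) - Kᵀ * (Bᵀ * X * B) * K := by
    rw [← hGK]
    simp only [Matrix.mul_add, Matrix.add_mul, Matrix.mul_assoc]
    abel
  have h2 : ricc A B Q R X = Q + Aᵀ * X * A - Aᵀ * X * B * K := by
    rw [ricc, hK]
    simp only [Matrix.mul_sub, Matrix.sub_mul, Matrix.mul_assoc]
    abel
  rw [h2, h1]
  simp only [Matrix.transpose_sub, Matrix.transpose_mul, Matrix.mul_sub, Matrix.sub_mul,
    Matrix.mul_assoc]
  abel

lemma ricc_posDef {n m : ℕ} (A : Matrix (Fin n) (Fin n) ℝ) (B : Matrix (Fin n) (Fin m) ℝ)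
    (Q : Matrix (Fin n) (Fin n) ℝ) (R : Matrix (Fin m) (Fin m) ℝ)
    (X : Matrix (Fin n) (Fin n) ℝ) (hQ : Q.PosDef)
    (hR : R.PosDef) (hX : X.PosDef) : (ricc A B Q R X).PosDef := by
  rw [ricc_closed_loop A B Q R X _ hR hX rfl]
  refine (hQ.add_posSemidef ?_).add_posSemidef ?_
  · simpa only [conjTranspose_eq_transpose_of_trivial] using
      hR.posSemidef.conjTranspose_mul_mul_same ((R + Bᵀ * X * B)⁻¹ * (Bᵀ * X * A))
  · simpa only [conjTranspose_eq_transpose_of_trivial] using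
      hX.posSemidef.conjTranspose_mul_mul_same (A - B * ((R + Bᵀ * X * B)⁻¹ * (Bᵀ * X * A)))

lemma quad_conj {n m : ℕ} (M : Matrix (Fin m) (Fin m) ℝ) (F : Matrix (Fin m) (Fin n) ℝ)
    (v : Fin n → ℝ) : v ⬝ᵥ (Fᵀ * M * F) *ᵥ v = (F *ᵥ v) ⬝ᵥ M *ᵥ (F *ᵥ v) := by
  rw [Matrix.mul_assoc, ← Matrix.mulVec_mulVec, Matrix.dotProduct_mulVec, Matrix.vecMul_transpose,
    ← Matrix.mulVec_mulVec]

lemma quad_nonneg {n : ℕ} {M : Matrix (Fin n) (Fin n) ℝ} (hM : M.PosSemidef) (v : Fin n → ℝ) :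
    0 ≤ v ⬝ᵥ M *ᵥ v := by
  simpa using hM.dotProduct_mulVec_nonneg v

lemma quad_le_of_sub {n : ℕ} {M N : Matrix (Fin n) (Fin n) ℝ} (h : (N - M).PosSemidef)
    (v : Fin n → ℝ) : v ⬝ᵥ M *ᵥ v ≤ v ⬝ᵥ N *ᵥ v := by
  have := quad_nonneg h v
  rw [Matrix.sub_mulVec, dotProduct_sub] at this
  linarith

open scoped MatrixOrder in
lemma quad_le_exp_of_riemDelta {n : ℕ} {Y Z : Matrix (Fin n) (Fin n) ℝ} (hY : Y.PosDef)
    (hZ : Z.PosDef) {η : ℝ} (h : riemDelta Y Z ≤ η) (v : Fin n → ℝ) :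
    v ⬝ᵥ Y *ᵥ v ≤ Real.exp η * (v ⬝ᵥ Z *ᵥ v) := by
  obtain ⟨S, hS⟩ := CStarAlgebra.nonneg_iff_eq_star_mul_self.1 hZ.posSemidef.nonneg
  have hS' : Z = Sᵀ * S := by
    rw [hS, Matrix.star_eq_conjTranspose, conjTranspose_eq_transpose_of_trivial]
  have hZdet : IsUnit Z.det := (Matrix.isUnit_iff_isUnit_det _).1 hZ.isUnit
  have hSdet : IsUnit S.det := by
    rw [hS', Matrix.det_mul] at hZdet
    exact isUnit_of_mul_isUnit_right hZdet
  have hSinv : S⁻¹ * S = 1 := Matrix.nonsing_inv_mul _ hSdet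
  set M : Matrix (Fin n) (Fin n) ℝ := (S⁻¹)ᵀ * Y * S⁻¹ with hMdef
  have hMp : M.PosSemidef := by
    simpa only [conjTranspose_eq_transpose_of_trivial] using
      hY.posSemidef.conjTranspose_mul_mul_same S⁻¹
  have hchar : (Y * Z⁻¹).charpoly = M.charpoly := by
    rw [hMdef, Matrix.mul_assoc, Matrix.charpoly_mul_comm ((S⁻¹)ᵀ), hS', Matrix.mul_inv_rev,
      Matrix.transpose_nonsing_inv, Matrix.mul_assoc]
  have hMh : M.IsHermitian := hMp.isHermitian
  have hYM : Y = Sᵀ * M * S := by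
    have h3 : Sᵀ * (S⁻¹)ᵀ = 1 := by rw [← Matrix.transpose_mul, hSinv, Matrix.transpose_one]
    calc Y = (Sᵀ * (S⁻¹)ᵀ) * Y * (S⁻¹ * S) := by rw [h3, hSinv, Matrix.one_mul, Matrix.mul_one]
      _ = _ := by rw [hMdef]; simp only [Matrix.mul_assoc]
  have heig : ∀ i, hMh.eigenvalues i ≤ Real.exp η := by
    intro i
    rw [riemDelta, hchar, hMh.roots_charpoly_eq_eigenvalues, Multiset.map_map] at h
    have h4 : Real.log (hMh.eigenvalues i) ^ 2 ≤ ∑ j, Real.log (hMh.eigenvalues j) ^ 2 :=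
      Finset.single_le_sum (f := fun j => Real.log (hMh.eigenvalues j) ^ 2)
        (fun j _ => sq_nonneg _) (Finset.mem_univ i)
    have h5 : Real.log (hMh.eigenvalues i) ≤ η :=
      (Real.le_sqrt_of_sq_le h4).trans h
    rcases (hMp.eigenvalues_nonneg i).eq_or_lt with h0 | h0
    · rw [← h0]; exact (Real.exp_pos _).le
    · exact (Real.log_le_iff_le_exp h0).1 h5
  have hle : M ≤ algebraMap ℝ _ (Real.exp η) := by
    refine le_algebraMap_of_spectrum_le (p := IsSelfAdjoint) ?_ hMh
    intro r hr
    rw [hMh.spectrum_real_eq_range_eigenvalues] at hr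
    obtain ⟨i, rfl⟩ := hr
    exact heig i
  have h6 := quad_le_of_sub (Matrix.le_iff.1 hle) (S *ᵥ v)
  rw [← quad_conj, ← hYM, Algebra.algebraMap_eq_smul_one, Matrix.smul_mulVec, Matrix.one_mulVec,
    dotProduct_smul] at h6
  have h7 : v ⬝ᵥ Z *ᵥ v = (S *ᵥ v) ⬝ᵥ (S *ᵥ v) := by
    have := quad_conj 1 S v
    rwa [Matrix.mul_one, Matrix.one_mulVec, ← hS'] at this
  rw [h7]
  exact h6

lemma quad_le_specNorm {n : ℕ} (M : Matrix (Fin n) (Fin n) ℝ) (v : Fin n → ℝ) :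
    v ⬝ᵥ M *ᵥ v ≤ specNorm M * (v ⬝ᵥ v) := by
  set w : EuclideanSpace ℝ (Fin n) := WithLp.toLp 2 v with hw
  have h1 := Matrix.inner_toEuclideanCLM M w w
  have h2 : inner ℝ w w = v ⬝ᵥ v := by
    rw [PiLp.inner_apply]
    simp [hw, dotProduct, sq]
  have h3 : w.ofLp = v := rfl
  rw [h3] at h1
  rw [← h1, ← h2, real_inner_self_eq_norm_sq]
  calc _ ≤ ‖w‖ * ‖Matrix.toEuclideanCLM (𝕜 := ℝ) M w‖ := real_inner_le_norm _ _
    _ ≤ ‖w‖ * (specNorm M * ‖w‖) := by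
      gcongr
      exact ContinuousLinearMap.le_opNorm _ _
    _ = _ := by ring

lemma lamMin_le_specNorm {n : ℕ} (hn : 0 < n) {M : Matrix (Fin n) (Fin n) ℝ}
    (hM : M.IsHermitian) : lamMin M ≤ specNorm M := by
  have h0 : hM.eigenvalues ⟨0, hn⟩ ∈ spectrum ℝ M := by
    rw [hM.spectrum_real_eq_range_eigenvalues]; exact ⟨_, rfl⟩
  have h1 : lamMin M ≤ hM.eigenvalues ⟨0, hn⟩ := by
    refine csInf_le ?_ h0
    rw [hM.spectrum_real_eq_range_eigenvalues]
    exact (Set.finite_range _).bddBelow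
  have : Nonempty (Fin n) := ⟨⟨0, hn⟩⟩
  have h2 : hM.eigenvalues ⟨0, hn⟩ ∈ spectrum ℝ (Matrix.toEuclideanCLM (𝕜 := ℝ) M) := by
    rw [AlgEquiv.spectrum_eq]; exact h0
  exact h1.trans ((le_abs_self _).trans (spectrum.norm_le_norm_of_mem h2))

/-- infinite-horizon performance-loss bound for the one-step
receding-horizon policy. -/
theorem one_step_rh_performance_loss {n m : ℕ}
    (A : ℕ → Matrix (Fin n) (Fin n) ℝ) (B : ℕ → Matrix (Fin n) (Fin m) ℝ)
    (Q : ℕ → Matrix (Fin n) (Fin n) ℝ) (R : ℕ → Matrix (Fin m) (Fin m) ℝ)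
    (hQ : ∀ t, (Q t).PosDef) (hR : ∀ t, (R t).PosDef)
    (hcontr : ∀ t, ∀ Y Z : Matrix (Fin n) (Fin n) ℝ, Y.PosDef → Z.PosDef →
      riemDelta (ricc (A t) (B t) (Q t) (R t) Y) (ricc (A t) (B t) (Q t) (R t) Z)
        ≤ riemDelta Y Z)
    (P : ℕ → Matrix (Fin n) (Fin n) ℝ) (hPpos : ∀ t, (P t).PosDef)
    (hPrec : ∀ t, P t = ricc (A t) (B t) (Q t) (R t) (P (t + 1)))
    (Xh : ℕ → Matrix (Fin n) (Fin n) ℝ) (hXpos : ∀ t, (Xh (t + 1)).PosDef)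
    (η : ℝ) (hη : 0 < η)
    (hXdec : ∀ t, 1 ≤ t → (Xh t - ricc (A t) (B t) (Q t) (R t) (Xh (t + 1))).PosSemidef)
    (hXP : ∀ t, 1 ≤ t → (Xh t - P t).PosSemidef)
    (hXPd : ∀ t, 1 ≤ t → riemDelta (Xh t) (P t) ≤ η)
    (K : ℕ → Matrix (Fin m) (Fin n) ℝ)
    (hK : ∀ t, K t = (R t + (B t)ᵀ * Xh (t + 1) * B t)⁻¹ * ((B t)ᵀ * Xh (t + 1) * A t))
    (ξ : Fin n → ℝ) (x : ℕ → Fin n → ℝ) (u : ℕ → Fin m → ℝ)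
    (hx0 : x 0 = ξ) (hu : ∀ t, u t = -(K t *ᵥ x t))
    (hx : ∀ t, x (t + 1) = A t *ᵥ x t + B t *ᵥ u t)
    (wbar wlow lamlow lambar : ℝ)
    (hwbar : 0 < wbar) (hwlow : 0 < wlow) (hlamlow : 0 < lamlow) (hlambar : 0 < lambar)
    (hlw : lamlow ≤ wbar)
    (hub : ∀ t, specNorm (ricc (A t) (B t) (Q t) (R t) (Xh (t + 1))) ≤ wbar)
    (hlb : ∀ t, wlow ≤ lamMin (ricc (A t) (B t) (Q t) (R t) (Xh (t + 1))))
    (hgain : ∀ t, lamlow ≤ lamMin (Q t + (K t)ᵀ * R t * K t))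
    (hPb : ∀ t, specNorm (P t) ≤ lambar) :
    Summable (fun t => x t ⬝ᵥ Q t *ᵥ x t + u t ⬝ᵥ R t *ᵥ u t) ∧
    (∑' t, (x t ⬝ᵥ Q t *ᵥ x t + u t ⬝ᵥ R t *ᵥ u t)) - ξ ⬝ᵥ P 0 *ᵥ ξ
      ≤ (lambar / lamlow) * (wbar / wlow) * wbar * (Real.exp η - 1) * (ξ ⬝ᵥ ξ) := by
  set W : ℕ → Matrix (Fin n) (Fin n) ℝ :=
    fun t => ricc (A t) (B t) (Q t) (R t) (Xh (t + 1)) with hW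
  have hWpos : ∀ t, (W t).PosDef := fun t =>
    ricc_posDef _ _ _ _ _ (hQ t) (hR t) (hXpos t)
  have hc0 : ∀ t, 0 ≤ x t ⬝ᵥ Q t *ᵥ x t + u t ⬝ᵥ R t *ᵥ u t := fun t =>
    add_nonneg (quad_nonneg (hQ t).posSemidef _) (quad_nonneg (hR t).posSemidef _)
  have hstep : ∀ t, x t ⬝ᵥ Q t *ᵥ x t + u t ⬝ᵥ R t *ᵥ u t
      ≤ x t ⬝ᵥ W t *ᵥ x t - x (t + 1) ⬝ᵥ W (t + 1) *ᵥ x (t + 1) := by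
    intro t
    have h1 := quad_le_of_sub (hXdec (t + 1) (by omega)) (x (t + 1))
    have hxF : x (t + 1) = (A t - B t * K t) *ᵥ x t := by
      rw [hx, hu, Matrix.sub_mulVec, Matrix.mulVec_neg, Matrix.mulVec_mulVec, sub_eq_add_neg]
    have h2 : x t ⬝ᵥ W t *ᵥ x t = x t ⬝ᵥ Q t *ᵥ x t + u t ⬝ᵥ R t *ᵥ u t
        + x (t + 1) ⬝ᵥ Xh (t + 1) *ᵥ x (t + 1) := by
      simp only [hW]
      rw [ricc_closed_loop _ _ _ _ _ (K t) (hR t) (hXpos t) (hK t), Matrix.add_mulVec,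
        Matrix.add_mulVec, dotProduct_add, dotProduct_add, quad_conj, quad_conj, ← hxF, hu,
        Matrix.mulVec_neg, neg_dotProduct_neg]
    have h3 : x (t + 1) ⬝ᵥ W (t + 1) *ᵥ x (t + 1)
      ≤ x (t + 1) ⬝ᵥ Xh (t + 1) *ᵥ x (t + 1) := h1
    linarith
  have hsum : ∀ N, ∑ t ∈ Finset.range N, (x t ⬝ᵥ Q t *ᵥ x t + u t ⬝ᵥ R t *ᵥ u t)
      ≤ ξ ⬝ᵥ W 0 *ᵥ ξ := by
    intro N
    have h1 := Finset.sum_le_sum (s := Finset.range N) (fun t _ => hstep t)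
    rw [Finset.sum_range_sub' (fun t => x t ⬝ᵥ W t *ᵥ x t), hx0] at h1
    have h2 := quad_nonneg (hWpos N).posSemidef (x N)
    linarith
  refine ⟨summable_of_sum_range_le hc0 hsum, ?_⟩
  have htsum := Real.tsum_le_of_sum_range_le hc0 hsum
  have hδ : riemDelta (W 0) (P 0) ≤ η := by
    rw [hPrec 0]
    exact (hcontr 0 _ _ (hXpos 0) (hPpos 1)).trans (hXPd 1 le_rfl)
  have h1 := quad_le_exp_of_riemDelta (hWpos 0) (hPpos 0) hδ ξ
  have hξ : 0 ≤ ξ ⬝ᵥ ξ := by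
    simpa using quad_nonneg (M := (1 : Matrix (Fin n) (Fin n) ℝ)) Matrix.PosSemidef.one ξ
  have h2 : ξ ⬝ᵥ P 0 *ᵥ ξ ≤ lambar * (ξ ⬝ᵥ ξ) :=
    (quad_le_specNorm _ _).trans (mul_le_mul_of_nonneg_right (hPb 0) hξ)
  have he : 0 ≤ Real.exp η - 1 := by
    have := Real.add_one_le_exp η
    linarith
  have h3 : (∑' t, (x t ⬝ᵥ Q t *ᵥ x t + u t ⬝ᵥ R t *ᵥ u t)) - ξ ⬝ᵥ P 0 *ᵥ ξ
      ≤ (Real.exp η - 1) * (lambar * (ξ ⬝ᵥ ξ)) := by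
    have := mul_le_mul_of_nonneg_left h2 he
    linarith
  refine h3.trans ?_
  have h4 : 0 ≤ lambar * (Real.exp η - 1) * (ξ ⬝ᵥ ξ) := by positivity
  rcases Nat.eq_zero_or_pos n with hn | hn
  · subst hn
    simp [dotProduct]
  have hww : wlow ≤ wbar :=
    (hlb 0).trans ((lamMin_le_specNorm hn (hWpos 0).isHermitian).trans (hub 0))
  have h5 : 1 ≤ wbar / lamlow := (one_le_div hlamlow).2 hlw
  have h6 : 1 ≤ wbar / wlow := (one_le_div hwlow).2 hww
  have h7 : 1 ≤ (wbar / lamlow) * (wbar / wlow) := one_le_mul_of_one_le_of_one_le h5 h6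
  calc (Real.exp η - 1) * (lambar * (ξ ⬝ᵥ ξ))
      = 1 * (lambar * (Real.exp η - 1) * (ξ ⬝ᵥ ξ)) := by ring
    _ ≤ ((wbar / lamlow) * (wbar / wlow)) * (lambar * (Real.exp η - 1) * (ξ ⬝ᵥ ξ)) :=
        mul_le_mul_of_nonneg_right h7 h4
    _ = _ := by ring
end

section
/- Performance-loss bound for the T-step receding-horizon policy under Riccati contraction: fix T ≥ 1 and let (A_t)_{t∈ℕ} ⊂ ℝ^{n×n}, (B_t)_{t∈ℕ} ⊂ ℝ^{n×m}, symmetric positive definite (Q_t)_{t∈ℕ} ⊂ ℝ^{n×n} and symmetric positive definite (R_t)_{t∈ℕ} ⊂ ℝ^{m×m} be given, and suppose there is ρ ∈ (0,1) such that δ(𝓡_t(Y), 𝓡_t(Z)) ≤ ρ · δ(Y,Z) for all t ∈ ℕ and all symmetric positive definite Y, Z. Let (P_t)_{t∈ℕ} be symmetric positive definite with P_t = 𝓡_t(P_{t+1}) for all t, and let (X_s)_{s∈ℕ} be symmetric positive definite matrices satisfying, for all s: 𝓡_s(X_{s+1}) ⪯ X_s, P_s ⪯ X_s, and δ(X_s,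 P_s) ≤ δ̄ for some δ̄ > 0. Define X̂_s := 𝓡_s ∘ ⋯ ∘ 𝓡_{s+T−2}(X_{s+T−1}) (with X̂_s := X_s when T = 1), let K_t := (R_t + B_tᵀ X̂_{t+1} B_t)⁻¹ B_tᵀ X̂_{t+1} A_t, and from x_0 = ξ ∈ ℝⁿ let x_{t+1} = A_t x_t + B_t u_t with u_t = −K_t x_t. Suppose ω̄, ω̲, λ̲, λ̄ > 0 satisfy, for all t ∈ ℕ: ‖𝓡_t(X̂_{t+1})‖₂ ≤ ω̄, λ_min(𝓡_t(X̂_{t+1})) ≥ ω̲, λ_min(Q_t + K_tᵀ R_t K_t) ≥ λ̲, λ̲ ≤ ω̄, and ‖P_t‖₂ ≤ λ̄. Then the series Σ_{t=0}^∞ (x_tᵀ Q_t x_t + u_tᵀ R_t u_t) converges and Σ_{t=0}^∞ (x_tᵀ Q_t x_t + u_tᵀ R_t u_t) − ξᵀ P_0 ξ ≤ (λ̄/λ̲) · (ω̄/ω̲) · ω̄ · (exp(ρ^{T−1} · δ̄) − 1) · |ξ|². -/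
open Matrix

/-- `riccIter A B Q R s k X = 𝓡_s ∘ 𝓡_{s+1} ∘ ⋯ ∘ 𝓡_{s+k−1} (X)`. -/
noncomputable def riccIter {n m : ℕ} (A : ℕ → Matrix (Fin n) (Fin n) ℝ)
    (B : ℕ → Matrix (Fin n) (Fin m) ℝ) (Q : ℕ → Matrix (Fin n) (Fin n) ℝ)
    (R : ℕ → Matrix (Fin m) (Fin m) ℝ) :
    ℕ → ℕ → Matrix (Fin n) (Fin n) ℝ → Matrix (Fin n) (Fin n) ℝ
  | _, 0, X => X
  | s, k + 1, X => ricc (A s) (B s) (Q s) (R s) (riccIter A B Q R (s + 1) k X)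

/-- Symmetry of bilinear form. -/
lemma aux_symm {n : ℕ} {P : Matrix (Fin n) (Fin n) ℝ} (hP : P.IsHermitian) (x y : Fin n → ℝ) :
    x ⬝ᵥ P *ᵥ y = y ⬝ᵥ P *ᵥ x := by
  have h : Pᵀ = P := by simpa [Matrix.IsHermitian] using hP
  rw [Matrix.dotProduct_mulVec, ← Matrix.mulVec_transpose, h, dotProduct_comm]

lemma aux_G_posDef {n m : ℕ} {B : Matrix (Fin n) (Fin m) ℝ} {R : Matrix (Fin m) (Fin m) ℝ}
    {P : Matrix (Fin n) (Fin n) ℝ} (hR : R.PosDef) (hP : P.PosSemidef) :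
    (R + Bᵀ * P * B).PosDef := by
  have := hP.conjTranspose_mul_mul_same B
  rw [conjTranspose_eq_transpose_of_trivial] at this
  exact hR.add_posSemidef this

lemma aux_ricc_herm {n m : ℕ} (A : Matrix (Fin n) (Fin n) ℝ) (B : Matrix (Fin n) (Fin m) ℝ)
    {Q : Matrix (Fin n) (Fin n) ℝ} {R : Matrix (Fin m) (Fin m) ℝ}
    {P : Matrix (Fin n) (Fin n) ℝ} (hQ : Q.PosDef) (hR : R.PosDef) (hP : P.PosSemidef) :
    (ricc A B Q R P).IsHermitian := by
  have h1 : Pᵀ = P := by simpa [Matrix.IsHermitian] using hP.1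
  have h2 : Qᵀ = Q := by simpa [Matrix.IsHermitian] using hQ.1
  have h3 : (R + Bᵀ * P * B)ᵀ = R + Bᵀ * P * B := by
    simpa only [Matrix.IsHermitian, conjTranspose_eq_transpose_of_trivial] using
      (aux_G_posDef (B := B) hR hP).1
  have h4 : ((R + Bᵀ * P * B)⁻¹)ᵀ = (R + Bᵀ * P * B)⁻¹ := by
    rw [Matrix.transpose_nonsing_inv, h3]
  rw [Matrix.IsHermitian, conjTranspose_eq_transpose_of_trivial, ricc]
  generalize (R + Bᵀ * P * B)⁻¹ = H at h4 ⊢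
  simp only [Matrix.transpose_add, Matrix.transpose_sub, Matrix.transpose_mul,
    Matrix.transpose_transpose, h1, h2, h4, Matrix.mul_assoc]

/-- Completion of squares. -/
lemma aux_complete {n m : ℕ} (A : Matrix (Fin n) (Fin n) ℝ) (B : Matrix (Fin n) (Fin m) ℝ)
    (Q : Matrix (Fin n) (Fin n) ℝ) {R : Matrix (Fin m) (Fin m) ℝ}
    {P : Matrix (Fin n) (Fin n) ℝ} (hR : R.PosDef) (hP : P.PosSemidef)
    (x : Fin n → ℝ) (u w : Fin m → ℝ)
    (hw : w = ((R + Bᵀ * P * B)⁻¹ * (Bᵀ * P * A)) *ᵥ x) :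
    x ⬝ᵥ Q *ᵥ x + u ⬝ᵥ R *ᵥ u + (A *ᵥ x + B *ᵥ u) ⬝ᵥ P *ᵥ (A *ᵥ x + B *ᵥ u)
      = x ⬝ᵥ ricc A B Q R P *ᵥ x + (u + w) ⬝ᵥ (R + Bᵀ * P * B) *ᵥ (u + w) := by
  have hG := aux_G_posDef (B := B) hR hP
  set G := R + Bᵀ * P * B with hGdef
  have hGw : G *ᵥ w = Bᵀ *ᵥ (P *ᵥ (A *ᵥ x)) := by
    rw [hw, Matrix.mulVec_mulVec, ← Matrix.mul_assoc,
      Matrix.mul_nonsing_inv _ ((Matrix.isUnit_iff_isUnit_det _).1 hG.isUnit)]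
    simp [Matrix.mul_assoc]
  have hGu : G *ᵥ u = R *ᵥ u + Bᵀ *ᵥ (P *ᵥ (B *ᵥ u)) := by
    rw [hGdef, Matrix.add_mulVec]
    simp [Matrix.mul_assoc]
  have hB : ∀ (v : Fin m → ℝ) (y : Fin n → ℝ), v ⬝ᵥ Bᵀ *ᵥ y = (B *ᵥ v) ⬝ᵥ y := by
    intro v y
    rw [Matrix.dotProduct_mulVec, Matrix.vecMul_transpose]
  have hA : ∀ (v : Fin n → ℝ) (y : Fin n → ℝ), v ⬝ᵥ Aᵀ *ᵥ y = (A *ᵥ v) ⬝ᵥ y := by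
    intro v y
    rw [Matrix.dotProduct_mulVec, Matrix.vecMul_transpose]
  have hr : ricc A B Q R P *ᵥ x
      = Q *ᵥ x + Aᵀ *ᵥ (P *ᵥ (A *ᵥ x) - P *ᵥ (B *ᵥ w)) := by
    rw [hw, ricc, ← hGdef]
    simp [Matrix.add_mulVec, Matrix.mul_assoc, Matrix.sub_mul, Matrix.mul_sub, Matrix.sub_mulVec, Matrix.mulVec_sub]
  rw [hr]
  simp only [Matrix.mulVec_add, hGw, hGu, dotProduct_add, add_dotProduct, hB, hA,
    dotProduct_sub]
  have e1 := aux_symm hP.1 (B *ᵥ u) (A *ᵥ x)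
  have e2 := aux_symm hP.1 (B *ᵥ w) (A *ᵥ x)
  have e3 : w ⬝ᵥ R *ᵥ u + (B *ᵥ w) ⬝ᵥ P *ᵥ (B *ᵥ u) = (B *ᵥ u) ⬝ᵥ P *ᵥ (A *ᵥ x) := by
    have := aux_symm hG.1 w u
    rw [hGw, hGu] at this
    simpa only [dotProduct_add, hB] using this
  linarith

lemma aux_ricc_le {n m : ℕ} (A : Matrix (Fin n) (Fin n) ℝ) (B : Matrix (Fin n) (Fin m) ℝ)
    (Q : Matrix (Fin n) (Fin n) ℝ) {R : Matrix (Fin m) (Fin m) ℝ}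
    {P : Matrix (Fin n) (Fin n) ℝ} (hR : R.PosDef) (hP : P.PosSemidef)
    (x : Fin n → ℝ) (u : Fin m → ℝ) :
    x ⬝ᵥ ricc A B Q R P *ᵥ x ≤
    x ⬝ᵥ Q *ᵥ x + u ⬝ᵥ R *ᵥ u + (A *ᵥ x + B *ᵥ u) ⬝ᵥ P *ᵥ (A *ᵥ x + B *ᵥ u) := by
  rw [aux_complete A B Q hR hP x u _ rfl]
  have := (aux_G_posDef (B := B) hR hP).posSemidef.dotProduct_mulVec_nonneg
    (u + ((R + Bᵀ * P * B)⁻¹ * (Bᵀ * P * A)) *ᵥ x)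
  simp only [star_trivial] at this
  linarith

lemma aux_ricc_eq {n m : ℕ} (A : Matrix (Fin n) (Fin n) ℝ) (B : Matrix (Fin n) (Fin m) ℝ)
    (Q : Matrix (Fin n) (Fin n) ℝ) {R : Matrix (Fin m) (Fin m) ℝ}
    {P : Matrix (Fin n) (Fin n) ℝ} (hR : R.PosDef) (hP : P.PosSemidef)
    (x : Fin n → ℝ) (u : Fin m → ℝ)
    (hu : u = - (((R + Bᵀ * P * B)⁻¹ * (Bᵀ * P * A)) *ᵥ x)) :
    x ⬝ᵥ Q *ᵥ x + u ⬝ᵥ R *ᵥ u + (A *ᵥ x + B *ᵥ u) ⬝ᵥ P *ᵥ (A *ᵥ x + B *ᵥ u)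
      = x ⬝ᵥ ricc A B Q R P *ᵥ x := by
  rw [aux_complete A B Q hR hP x u _ rfl]
  have : u + ((R + Bᵀ * P * B)⁻¹ * (Bᵀ * P * A)) *ᵥ x = 0 := by rw [hu]; simp
  rw [this]; simp

lemma aux_ricc_posDef {n m : ℕ} (A : Matrix (Fin n) (Fin n) ℝ) (B : Matrix (Fin n) (Fin m) ℝ)
    {Q : Matrix (Fin n) (Fin n) ℝ} {R : Matrix (Fin m) (Fin m) ℝ}
    {P : Matrix (Fin n) (Fin n) ℝ} (hQ : Q.PosDef) (hR : R.PosDef) (hP : P.PosDef) :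
    (ricc A B Q R P).PosDef := by
  refine Matrix.PosDef.of_dotProduct_mulVec_pos (aux_ricc_herm A B hQ hR hP.posSemidef) ?_
  intro x hx
  rw [star_trivial, ← aux_ricc_eq A B Q hR hP.posSemidef x _ rfl]
  have h1 := hQ.dotProduct_mulVec_pos hx
  have h2 := hR.posSemidef.dotProduct_mulVec_nonneg
    (-(((R + Bᵀ * P * B)⁻¹ * (Bᵀ * P * A)) *ᵥ x))
  have h3 := hP.posSemidef.dotProduct_mulVec_nonneg
    (A *ᵥ x + B *ᵥ (-(((R + Bᵀ * P * B)⁻¹ * (Bᵀ * P * A)) *ᵥ x)))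
  simp only [star_trivial] at h1 h2 h3
  linarith

/-- quadratic-form version of the Loewner order -/
lemma aux_le_iff {n : ℕ} {Y Z : Matrix (Fin n) (Fin n) ℝ} (h : (Z - Y).PosSemidef)
    (x : Fin n → ℝ) : x ⬝ᵥ Y *ᵥ x ≤ x ⬝ᵥ Z *ᵥ x := by
  have := h.dotProduct_mulVec_nonneg x
  simp only [star_trivial, Matrix.sub_mulVec, dotProduct_sub] at this
  linarith

lemma aux_ricc_mono {n m : ℕ} (A : Matrix (Fin n) (Fin n) ℝ) (B : Matrix (Fin n) (Fin m) ℝ)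
    (Q : Matrix (Fin n) (Fin n) ℝ) {R : Matrix (Fin m) (Fin m) ℝ}
    {Y Z : Matrix (Fin n) (Fin n) ℝ} (hR : R.PosDef) (hY : Y.PosDef)
    (hZ : Z.PosDef) (h : ∀ x : Fin n → ℝ, x ⬝ᵥ Y *ᵥ x ≤ x ⬝ᵥ Z *ᵥ x) (x : Fin n → ℝ) :
    x ⬝ᵥ ricc A B Q R Y *ᵥ x ≤ x ⬝ᵥ ricc A B Q R Z *ᵥ x := by
  rw [← aux_ricc_eq A B Q hR hZ.posSemidef x _ rfl]
  refine (aux_ricc_le A B Q hR hY.posSemidef x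
    (-(((R + Bᵀ * Z * B)⁻¹ * (Bᵀ * Z * A)) *ᵥ x))).trans ?_
  gcongr
  exact h _

lemma aux_quad_le {n : ℕ} (P : Matrix (Fin n) (Fin n) ℝ) (x : Fin n → ℝ) :
    x ⬝ᵥ P *ᵥ x ≤ specNorm P * (x ⬝ᵥ x) := by
  have h1 : x ⬝ᵥ P *ᵥ x = inner ℝ (WithLp.toLp 2 x)
      (Matrix.toEuclideanCLM (𝕜 := ℝ) P (WithLp.toLp 2 x)) := by
    rw [Matrix.toEuclideanCLM_toLp, EuclideanSpace.inner_toLp_toLp, star_trivial,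
      dotProduct_comm]
  have h2 : x ⬝ᵥ x = ‖(WithLp.toLp 2 x : EuclideanSpace ℝ (Fin n))‖ ^ 2 := by
    rw [← real_inner_self_eq_norm_sq, EuclideanSpace.inner_toLp_toLp, star_trivial]
  rw [h1, h2, specNorm]
  refine (real_inner_le_norm _ _).trans ?_
  have := (Matrix.toEuclideanCLM (𝕜 := ℝ) P).le_opNorm (WithLp.toLp 2 x)
  nlinarith [norm_nonneg (WithLp.toLp 2 x : EuclideanSpace ℝ (Fin n))]

lemma aux_lamMin_le {n : ℕ} (M : Matrix (Fin n) (Fin n) ℝ) (h : 0 < lamMin M) :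
    lamMin M ≤ specNorm M := by
  have hne : (spectrum ℝ M).Nonempty := by
    by_contra hc
    rw [Set.not_nonempty_iff_eq_empty] at hc
    simp [lamMin, hc] at h
  obtain ⟨r, hr⟩ := hne
  have hn : Nonempty (Fin n) := by
    by_contra hc
    rw [not_nonempty_iff] at hc
    have : Subsingleton (Matrix (Fin n) (Fin n) ℝ) := inferInstance
    rw [spectrum.of_subsingleton] at hr
    exact hr
  have hnt : Nontrivial (EuclideanSpace ℝ (Fin n)) := inferInstance
  have hr' : r ∈ spectrum ℝ (Matrix.toEuclideanCLM (𝕜 := ℝ) (n := Fin n) M) := by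
    rw [AlgEquiv.spectrum_eq]
    exact hr
  have h1 : r ≤ specNorm M := (le_abs_self r).trans (spectrum.norm_le_norm_of_mem hr')
  refine le_trans (csInf_le ?_ hr) h1
  exact (Matrix.finite_real_spectrum (A := M)).bddBelow

lemma aux_delta {n : ℕ} {Y Z : Matrix (Fin n) (Fin n) ℝ} (hY : Y.PosDef) (hZ : Z.PosDef)
    {d : ℝ} (hd : riemDelta Y Z ≤ d) (x : Fin n → ℝ) :
    x ⬝ᵥ Y *ᵥ x ≤ Real.exp d * (x ⬝ᵥ Z *ᵥ x) := by
  obtain ⟨S, hS, hZS⟩ : ∃ S : Matrix (Fin n) (Fin n) ℝ, IsUnit S ∧ Z = Sᵀ * S := by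
    open scoped MatrixOrder Matrix.Norms.L2Operator in
    obtain ⟨S, hS, h⟩ := CStarAlgebra.isStrictlyPositive_iff_eq_star_mul_self.mp hZ.isStrictlyPositive
    exact ⟨S, hS, by rw [h, Matrix.star_eq_conjTranspose, conjTranspose_eq_transpose_of_trivial]⟩
  have hSd : IsUnit S.det := (Matrix.isUnit_iff_isUnit_det _).1 hS
  have hSi : S * S⁻¹ = 1 := Matrix.mul_nonsing_inv _ hSd
  have hSi' : S⁻¹ * S = 1 := Matrix.nonsing_inv_mul _ hSd
  set M := (S⁻¹)ᵀ * Y * S⁻¹ with hM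
  have hMh : M.IsHermitian := by
    have := hY.posSemidef.conjTranspose_mul_mul_same S⁻¹
    rw [conjTranspose_eq_transpose_of_trivial] at this
    exact this.1
  have hcp : (Y * Z⁻¹).charpoly = M.charpoly := by
    rw [hZS, Matrix.mul_inv_rev, ← Matrix.mul_assoc, Matrix.charpoly_mul_comm, hM,
      Matrix.transpose_nonsing_inv, Matrix.mul_assoc]
  have hspec : ∀ r ∈ spectrum ℝ M, r ≤ Real.exp d := by
    intro r hr
    rcases le_or_gt r 0 with h0 | h0
    · exact h0.trans (Real.exp_pos _).le
    have hroot : r ∈ (Y * Z⁻¹).charpoly.roots := by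
      rw [hcp, Polynomial.mem_roots (Matrix.charpoly_monic M).ne_zero]
      exact Matrix.mem_spectrum_iff_isRoot_charpoly.1 hr
    have h1 : Real.log r ^ 2 ≤
        (((Y * Z⁻¹).charpoly.roots).map (fun r => Real.log r ^ 2)).sum := by
      refine Multiset.single_le_sum ?_ _ (Multiset.mem_map_of_mem _ hroot)
      intro y hy
      obtain ⟨z, -, rfl⟩ := Multiset.mem_map.1 hy
      positivity
    have h2 : Real.log r ≤ d :=
      (le_abs_self _).trans ((Real.abs_le_sqrt h1).trans hd)
    exact (Real.log_le_iff_le_exp h0).1 h2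
  have hps : (algebraMap ℝ (Matrix (Fin n) (Fin n) ℝ) (Real.exp d) - M).PosSemidef := by
    rw [Matrix.posSemidef_iff_isHermitian_and_spectrum_nonneg]
    constructor
    · refine Matrix.IsHermitian.sub ?_ hMh
      rw [Matrix.algebraMap_eq_diagonal, Matrix.IsHermitian, Matrix.diagonal_conjTranspose]
      simp
    · rw [← spectrum.singleton_sub_eq]
      rintro _ ⟨a, ha, r, hr, rfl⟩
      rw [Set.mem_singleton_iff.1 ha]
      simpa using hspec r hr
  have h := hps.dotProduct_mulVec_nonneg (S *ᵥ x)
  have hMx : (S *ᵥ x) ⬝ᵥ M *ᵥ (S *ᵥ x) = x ⬝ᵥ Y *ᵥ x := by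
    have e : M *ᵥ (S *ᵥ x) = (S⁻¹)ᵀ *ᵥ (Y *ᵥ x) := by
      rw [Matrix.mulVec_mulVec, hM, Matrix.mul_assoc, hSi', Matrix.mul_one,
        Matrix.mulVec_mulVec]
    rw [e, Matrix.dotProduct_mulVec, Matrix.vecMul_transpose, Matrix.mulVec_mulVec, hSi',
      Matrix.one_mulVec]
  have hZx : (S *ᵥ x) ⬝ᵥ (S *ᵥ x) = x ⬝ᵥ Z *ᵥ x := by
    rw [hZS, ← Matrix.mulVec_mulVec, Matrix.dotProduct_mulVec x, Matrix.vecMul_transpose]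
  rw [star_trivial, Matrix.sub_mulVec, dotProduct_sub, hMx, Algebra.algebraMap_eq_smul_one,
    Matrix.smul_mulVec, Matrix.one_mulVec, dotProduct_smul, hZx, smul_eq_mul] at h
  linarith

lemma aux_iter_posDef {n m : ℕ} {A : ℕ → Matrix (Fin n) (Fin n) ℝ}
    {B : ℕ → Matrix (Fin n) (Fin m) ℝ} {Q : ℕ → Matrix (Fin n) (Fin n) ℝ}
    {R : ℕ → Matrix (Fin m) (Fin m) ℝ} (hQ : ∀ t, (Q t).PosDef) (hR : ∀ t, (R t).PosDef)
    {Y : Matrix (Fin n) (Fin n) ℝ} (hY : Y.PosDef) (k s : ℕ) :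
    (riccIter A B Q R s k Y).PosDef := by
  induction k generalizing s with
  | zero => exact hY
  | succ k ih => exact aux_ricc_posDef _ _ (hQ s) (hR s) (ih (s + 1))

lemma aux_iter_mono {n m : ℕ} {A : ℕ → Matrix (Fin n) (Fin n) ℝ}
    {B : ℕ → Matrix (Fin n) (Fin m) ℝ} {Q : ℕ → Matrix (Fin n) (Fin n) ℝ}
    {R : ℕ → Matrix (Fin m) (Fin m) ℝ} (hQ : ∀ t, (Q t).PosDef) (hR : ∀ t, (R t).PosDef)
    {Y Z : Matrix (Fin n) (Fin n) ℝ} (hY : Y.PosDef) (hZ : Z.PosDef)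
    (h : ∀ x : Fin n → ℝ, x ⬝ᵥ Y *ᵥ x ≤ x ⬝ᵥ Z *ᵥ x) (k s : ℕ) :
    ∀ x : Fin n → ℝ, x ⬝ᵥ riccIter A B Q R s k Y *ᵥ x ≤ x ⬝ᵥ riccIter A B Q R s k Z *ᵥ x := by
  induction k generalizing s with
  | zero => exact h
  | succ k ih =>
    exact aux_ricc_mono _ _ _ (hR s) (aux_iter_posDef hQ hR hY k (s + 1))
      (aux_iter_posDef hQ hR hZ k (s + 1)) (ih (s + 1))

lemma aux_iter_succ {n m : ℕ} (A : ℕ → Matrix (Fin n) (Fin n) ℝ)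
    (B : ℕ → Matrix (Fin n) (Fin m) ℝ) (Q : ℕ → Matrix (Fin n) (Fin n) ℝ)
    (R : ℕ → Matrix (Fin m) (Fin m) ℝ) (Y : Matrix (Fin n) (Fin n) ℝ) (k s : ℕ) :
    riccIter A B Q R s (k + 1) Y
      = riccIter A B Q R s k (ricc (A (s + k)) (B (s + k)) (Q (s + k)) (R (s + k)) Y) := by
  induction k generalizing s with
  | zero => rfl
  | succ k ih =>
    rw [riccIter, ih (s + 1), riccIter, show s + 1 + k = s + (k + 1) by omega]

lemma aux_iter_contr {n m : ℕ} {A : ℕ → Matrix (Fin n) (Fin n) ℝ}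
    {B : ℕ → Matrix (Fin n) (Fin m) ℝ} {Q : ℕ → Matrix (Fin n) (Fin n) ℝ}
    {R : ℕ → Matrix (Fin m) (Fin m) ℝ} (hQ : ∀ t, (Q t).PosDef) (hR : ∀ t, (R t).PosDef)
    {ρ : ℝ} (hρ0 : 0 < ρ)
    (hcontr : ∀ t, ∀ Y Z : Matrix (Fin n) (Fin n) ℝ, Y.PosDef → Z.PosDef →
      riemDelta (ricc (A t) (B t) (Q t) (R t) Y) (ricc (A t) (B t) (Q t) (R t) Z)
        ≤ ρ * riemDelta Y Z)
    {Y Z : Matrix (Fin n) (Fin n) ℝ} (hY : Y.PosDef) (hZ : Z.PosDef) (k s : ℕ) :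
    riemDelta (riccIter A B Q R s k Y) (riccIter A B Q R s k Z) ≤ ρ ^ k * riemDelta Y Z := by
  induction k generalizing s with
  | zero => simp [riccIter]
  | succ k ih =>
    refine (hcontr s _ _ (aux_iter_posDef hQ hR hY k (s + 1))
      (aux_iter_posDef hQ hR hZ k (s + 1))).trans ?_
    rw [pow_succ', mul_assoc]
    exact mul_le_mul_of_nonneg_left (ih (s + 1)) hρ0.le

lemma aux_iter_fix {n m : ℕ} {A : ℕ → Matrix (Fin n) (Fin n) ℝ}
    {B : ℕ → Matrix (Fin n) (Fin m) ℝ} {Q : ℕ → Matrix (Fin n) (Fin n) ℝ}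
    {R : ℕ → Matrix (Fin m) (Fin m) ℝ} {P : ℕ → Matrix (Fin n) (Fin n) ℝ}
    (hPrec : ∀ t, P t = ricc (A t) (B t) (Q t) (R t) (P (t + 1))) (k s : ℕ) :
    riccIter A B Q R s k (P (s + k)) = P s := by
  induction k generalizing s with
  | zero => rfl
  | succ k ih =>
    rw [riccIter, show s + (k + 1) = s + 1 + k by omega, ih, ← hPrec]

/-- performance-loss bound for the `T`-step receding-horizon policy
under strict Riccati contraction, with composed terminal penalties
`X̂_s = 𝓡_s ∘ ⋯ ∘ 𝓡_{s+T−2}(X_{s+T−1})`. -/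
theorem T_step_rh_performance_loss {n m : ℕ} (T : ℕ) (hT : 1 ≤ T)
    (A : ℕ → Matrix (Fin n) (Fin n) ℝ) (B : ℕ → Matrix (Fin n) (Fin m) ℝ)
    (Q : ℕ → Matrix (Fin n) (Fin n) ℝ) (R : ℕ → Matrix (Fin m) (Fin m) ℝ)
    (hQ : ∀ t, (Q t).PosDef) (hR : ∀ t, (R t).PosDef)
    (ρ : ℝ) (hρ0 : 0 < ρ) (hρ1 : ρ < 1)
    (hcontr : ∀ t, ∀ Y Z : Matrix (Fin n) (Fin n) ℝ, Y.PosDef → Z.PosDef →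
      riemDelta (ricc (A t) (B t) (Q t) (R t) Y) (ricc (A t) (B t) (Q t) (R t) Z)
        ≤ ρ * riemDelta Y Z)
    (P : ℕ → Matrix (Fin n) (Fin n) ℝ) (hPpos : ∀ t, (P t).PosDef)
    (hPrec : ∀ t, P t = ricc (A t) (B t) (Q t) (R t) (P (t + 1)))
    (X : ℕ → Matrix (Fin n) (Fin n) ℝ) (hXpos : ∀ s, (X s).PosDef)
    (δbar : ℝ) (hδbar : 0 < δbar)
    (hXdec : ∀ s, (X s - ricc (A s) (B s) (Q s) (R s) (X (s + 1))).PosSemidef)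
    (hXP : ∀ s, (X s - P s).PosSemidef)
    (hXPd : ∀ s, riemDelta (X s) (P s) ≤ δbar)
    (Xh : ℕ → Matrix (Fin n) (Fin n) ℝ)
    (hXh : ∀ s, Xh s = riccIter A B Q R s (T - 1) (X (s + (T - 1))))
    (K : ℕ → Matrix (Fin m) (Fin n) ℝ)
    (hK : ∀ t, K t = (R t + (B t)ᵀ * Xh (t + 1) * B t)⁻¹ * ((B t)ᵀ * Xh (t + 1) * A t))
    (ξ : Fin n → ℝ) (x : ℕ → Fin n → ℝ) (u : ℕ → Fin m → ℝ)
    (hx0 : x 0 = ξ) (hu : ∀ t, u t = -(K t *ᵥ x t))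
    (hx : ∀ t, x (t + 1) = A t *ᵥ x t + B t *ᵥ u t)
    (wbar wlow lamlow lambar : ℝ)
    (hwbar : 0 < wbar) (hwlow : 0 < wlow) (hlamlow : 0 < lamlow) (hlambar : 0 < lambar)
    (hlw : lamlow ≤ wbar)
    (hub : ∀ t, specNorm (ricc (A t) (B t) (Q t) (R t) (Xh (t + 1))) ≤ wbar)
    (hlb : ∀ t, wlow ≤ lamMin (ricc (A t) (B t) (Q t) (R t) (Xh (t + 1))))
    (hgain : ∀ t, lamlow ≤ lamMin (Q t + (K t)ᵀ * R t * K t))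
    (hPb : ∀ t, specNorm (P t) ≤ lambar) :
    Summable (fun t => x t ⬝ᵥ Q t *ᵥ x t + u t ⬝ᵥ R t *ᵥ u t) ∧
    (∑' t, (x t ⬝ᵥ Q t *ᵥ x t + u t ⬝ᵥ R t *ᵥ u t)) - ξ ⬝ᵥ P 0 *ᵥ ξ
      ≤ (lambar / lamlow) * (wbar / wlow) * wbar
          * (Real.exp (ρ ^ (T - 1) * δbar) - 1) * (ξ ⬝ᵥ ξ) := by
  obtain ⟨k, rfl⟩ : ∃ k, T = k + 1 := ⟨T - 1, by omega⟩
  simp only [Nat.add_sub_cancel] at hXh ⊢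
  set W : ℕ → Matrix (Fin n) (Fin n) ℝ :=
    fun t => ricc (A t) (B t) (Q t) (R t) (Xh (t + 1)) with hW
  have hXhpos : ∀ s, (Xh s).PosDef := fun s => by
    rw [hXh]; exact aux_iter_posDef hQ hR (hXpos _) _ _
  have hWpos : ∀ s, (W s).PosDef := fun s => aux_ricc_posDef _ _ (hQ s) (hR s) (hXhpos _)
  have hWit : ∀ s, W s = riccIter A B Q R s (k + 1) (X (s + (k + 1))) := fun s => by
    simp only [hW]
    rw [riccIter, hXh, show s + 1 + k = s + (k + 1) by omega]
  have hWXh : ∀ s, ∀ y : Fin n → ℝ, y ⬝ᵥ W s *ᵥ y ≤ y ⬝ᵥ Xh s *ᵥ y := fun s => by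
    rw [hWit, hXh, aux_iter_succ]
    exact aux_iter_mono hQ hR (aux_ricc_posDef _ _ (hQ _) (hR _) (hXpos _)) (hXpos _)
      (fun y => aux_le_iff (hXdec (s + k)) y) k s
  set c : ℕ → ℝ := fun t => x t ⬝ᵥ Q t *ᵥ x t + u t ⬝ᵥ R t *ᵥ u t with hc
  have hc0 : ∀ t, 0 ≤ c t := fun t => by
    have h1 := (hQ t).posSemidef.dotProduct_mulVec_nonneg (x t)
    have h2 := (hR t).posSemidef.dotProduct_mulVec_nonneg (u t)
    simp only [star_trivial] at h1 h2
    exact add_nonneg h1 h2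
  have hstep : ∀ t, c t + x (t + 1) ⬝ᵥ W (t + 1) *ᵥ x (t + 1) ≤ x t ⬝ᵥ W t *ᵥ x t := fun t => by
    have h1 := aux_ricc_eq (A t) (B t) (Q t) (hR t) (hXhpos (t + 1)).posSemidef (x t) (u t)
      (by rw [hu, hK])
    rw [← hx] at h1
    have h2 := hWXh (t + 1) (x (t + 1))
    simp only [hc]
    change _ = x t ⬝ᵥ W t *ᵥ x t at h1
    linarith
  have hpart : ∀ N, ∑ t ∈ Finset.range N, c t + x N ⬝ᵥ W N *ᵥ x N ≤ ξ ⬝ᵥ W 0 *ᵥ ξ := by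
    intro N
    induction N with
    | zero => simp [hx0]
    | succ N ih =>
      rw [Finset.sum_range_succ]
      have := hstep N
      linarith
  have hpart' : ∀ N, ∑ t ∈ Finset.range N, c t ≤ ξ ⬝ᵥ W 0 *ᵥ ξ := fun N => by
    have h1 := (hWpos N).posSemidef.dotProduct_mulVec_nonneg (x N)
    simp only [star_trivial] at h1
    have := hpart N
    linarith
  refine ⟨summable_of_sum_range_le hc0 hpart', ?_⟩
  have hsum : ∑' t, c t ≤ ξ ⬝ᵥ W 0 *ᵥ ξ := Real.tsum_le_of_sum_range_le hc0 hpart'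
  have hδ : riemDelta (W 0) (P 0) ≤ ρ ^ k * δbar := by
    have h1 := aux_iter_contr hQ hR hρ0 hcontr (hXpos (0 + (k + 1))) (hPpos (0 + (k + 1))) (k + 1) 0
    rw [aux_iter_fix hPrec, ← hWit] at h1
    refine h1.trans ?_
    have h2 : ρ ^ (k + 1) ≤ ρ ^ k := pow_le_pow_of_le_one hρ0.le hρ1.le (Nat.le_succ k)
    exact mul_le_mul h2 (hXPd _) (Real.sqrt_nonneg _) (by positivity)
  have hcmp := aux_delta (hWpos 0) (hPpos 0) hδ ξ
  have hww : wlow ≤ wbar :=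
    (hlb 0).trans ((aux_lamMin_le _ (hwlow.trans_le (hlb 0))).trans (hub 0))
  have hξ : 0 ≤ ξ ⬝ᵥ ξ := by
    simpa using dotProduct_star_self_nonneg ξ
  have hP0 : ξ ⬝ᵥ P 0 *ᵥ ξ ≤ lambar * (ξ ⬝ᵥ ξ) :=
    (aux_quad_le _ _).trans (mul_le_mul_of_nonneg_right (hPb 0) hξ)
  have hE : 0 ≤ Real.exp (ρ ^ k * δbar) - 1 := by
    have : 1 ≤ Real.exp (ρ ^ k * δbar) := Real.one_le_exp (by positivity)
    linarith
  have hcoef : lambar ≤ (lambar / lamlow) * (wbar / wlow) * wbar := by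
    have h1 : 1 ≤ wbar / lamlow := (one_le_div hlamlow).2 hlw
    have h2 : 1 ≤ wbar / wlow := (one_le_div hwlow).2 hww
    have h3 : 1 ≤ (wbar / lamlow) * (wbar / wlow) := one_le_mul_of_one_le_of_one_le h1 h2
    calc lambar = lambar * 1 := (mul_one _).symm
      _ ≤ lambar * ((wbar / lamlow) * (wbar / wlow)) := by gcongr
      _ = _ := by ring
  calc (∑' t, c t) - ξ ⬝ᵥ P 0 *ᵥ ξ
      ≤ (Real.exp (ρ ^ k * δbar) - 1) * (ξ ⬝ᵥ P 0 *ᵥ ξ) := by linarith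
    _ ≤ (Real.exp (ρ ^ k * δbar) - 1) * (lambar * (ξ ⬝ᵥ ξ)) := by gcongr
    _ = lambar * (Real.exp (ρ ^ k * δbar) - 1) * (ξ ⬝ᵥ ξ) := by ring
    _ ≤ _ := by gcongr
end
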